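/- arXiv:2202.00089 — 8 statements merged into one kernel-verified Lean document; each statement's English description precedes it below -/
import Mathlib

section
/- Let K = ∏_{j=1}^d [a_j, a_j + D∞] ⊂ ℝ^d be a closed hypercube of ℓ∞-diameter D∞ > 0, and let f : ℝ^d → ℝ be convex and differentiable. Fix x₁ ∈ K and η = D∞/√2, and define the AdaGrad iterates for t = 1,…,T by the coordinate-wise update x_{t+1,j} = Π_{[a_j, a_j+D∞]}( x_{t,j} − (η / √(∑_{i=1}^t (∂_j f(x_i))²)) · ∂_j f(x_t) ) for each coordinate j with ∑_{i=1}^t (∂_j f(x_i))² > 0, and x_{t+1,j} = x_{t,j} otherwise, where Π_{[a,b]} denotes clamping to the interval [a,b]. Then for every x ∈ K, ∑_{t=1}^T ( f(x_t) − f(x) ) ≤ √( 2 d D∞² ∑_{t=1}^T ‖∇f(x_t)‖² ), where ‖·‖ is the Euclidean norm. -/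
/-- Clamping to an interval does not increase the distance to a point of that interval. -/
lemma sq_clamp_sub_le {a b y : ℝ} (hy : y ∈ Set.Icc a b) (z : ℝ) :
    (max a (min b z) - y) ^ 2 ≤ (z - y) ^ 2 := by
  obtain ⟨h1, h2⟩ := hy
  rcases le_total b z with h | h
  · rw [min_eq_left h, max_eq_right (h1.trans h2)]
    nlinarith
  · rw [min_eq_right h]
    rcases le_total a z with h' | h'
    · rw [max_eq_right h']
    · rw [max_eq_left h']
      nlinarith

/-- One step of the AdaGrad potential argument: `s` and `s'` are the square roots of consecutive
sums of squared gradients, `u` and `u'` consecutive signed distances to the comparison point. -/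
lemma adagrad_potential_step {D η s s' g u u' : ℝ} (hη : 2 * η ^ 2 = D ^ 2) (hs : 0 ≤ s)
    (hs' : 0 < s') (hg : s' ^ 2 = s ^ 2 + g ^ 2) (hu : u ^ 2 ≤ D ^ 2)
    (hu' : u' ^ 2 ≤ (u - η / s' * g) ^ 2) :
    s * (2 * D ^ 2 - u ^ 2) + 2 * η * (g * u) ≤ s' * (2 * D ^ 2 - u' ^ 2) := by
  have hss : s ≤ s' := by nlinarith [sq_nonneg g]
  have h1 : s' * u' ^ 2 ≤ s' * u ^ 2 - 2 * η * (g * u) + η ^ 2 * (g ^ 2 / s') := by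
    calc s' * u' ^ 2 ≤ s' * (u - η / s' * g) ^ 2 := by gcongr
      _ = _ := by field_simp; ring
  have h2 : g ^ 2 / s' ≤ 2 * (s' - s) := by
    rw [div_le_iff₀ hs']
    nlinarith [sq_nonneg (s' - s)]
  nlinarith [mul_le_mul_of_nonneg_left h2 (sq_nonneg η),
    mul_le_mul_of_nonneg_left hu (sub_nonneg.2 hss)]

/-- The potential bound for one-dimensional projected AdaGrad. -/
lemma adagrad_coordinate_potential {T : ℕ} {a D η y : ℝ} {x g : ℕ → ℝ}
    (hη : 2 * η ^ 2 = D ^ 2) (hD : 0 ≤ D) (hx1 : x 1 ∈ Set.Icc a (a + D))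
    (hy : y ∈ Set.Icc a (a + D))
    (hupdate : ∀ t ∈ Finset.Icc 1 T,
      (0 < ∑ i ∈ Finset.Icc 1 t, g i ^ 2 →
        x (t + 1) = max a (min (a + D)
          (x t - η / √(∑ i ∈ Finset.Icc 1 t, g i ^ 2) * g t)))
      ∧ (∑ i ∈ Finset.Icc 1 t, g i ^ 2 ≤ 0 → x (t + 1) = x t)) :
    ∀ t ≤ T, x (t + 1) ∈ Set.Icc a (a + D) ∧
      2 * η * ∑ i ∈ Finset.Icc 1 t, g i * (x i - y)
        ≤ √(∑ i ∈ Finset.Icc 1 t, g i ^ 2) * (2 * D ^ 2 - (x (t + 1) - y) ^ 2) := by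
  intro t
  induction t with
  | zero => simpa using hx1
  | succ t ih =>
    intro ht
    obtain ⟨hmem, hpot⟩ := ih (by omega)
    obtain ⟨hpos, hzero⟩ := hupdate (t + 1) (by simp; omega)
    have hS : 0 ≤ ∑ i ∈ Finset.Icc 1 t, g i ^ 2 := Finset.sum_nonneg fun i _ => sq_nonneg _
    have hsum : ∑ i ∈ Finset.Icc 1 (t + 1), g i ^ 2
        = ∑ i ∈ Finset.Icc 1 t, g i ^ 2 + g (t + 1) ^ 2 :=
      Finset.sum_Icc_succ_top (by omega) _
    rw [Finset.sum_Icc_succ_top (by omega) fun i => g i * (x i - y)]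
    rcases le_or_gt (∑ i ∈ Finset.Icc 1 (t + 1), g i ^ 2) 0 with h0 | h0
    · have hg : g (t + 1) = 0 := by nlinarith [sq_nonneg (g (t + 1))]
      rw [hzero h0, hsum, hg]
      exact ⟨hmem, by simpa using hpot⟩
    · have hx := hpos h0
      refine ⟨hx ▸ ⟨le_max_left _ _, max_le (by linarith) (min_le_left _ _)⟩, ?_⟩
      have hu : (x (t + 1) - y) ^ 2 ≤ D ^ 2 :=
        sq_le_sq' (by linarith [hmem.1, hy.2]) (by linarith [hmem.2, hy.1])
      have hu' := sq_clamp_sub_le hy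
        (x (t + 1) - η / √(∑ i ∈ Finset.Icc 1 (t + 1), g i ^ 2) * g (t + 1))
      rw [← hx, sub_right_comm] at hu'
      have hstep := adagrad_potential_step hη
        (Real.sqrt_nonneg (∑ i ∈ Finset.Icc 1 t, g i ^ 2)) (Real.sqrt_pos.2 h0)
        (by rw [Real.sq_sqrt h0.le, Real.sq_sqrt hS, hsum]) hu hu'
      linarith

/-- The regret bound for one-dimensional projected AdaGrad. -/
lemma adagrad_coordinate_regret {T : ℕ} {a D y : ℝ} {x g : ℕ → ℝ}
    (hD : 0 < D) (hx1 : x 1 ∈ Set.Icc a (a + D)) (hy : y ∈ Set.Icc a (a + D))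
    (hupdate : ∀ t ∈ Finset.Icc 1 T,
      (0 < ∑ i ∈ Finset.Icc 1 t, g i ^ 2 →
        x (t + 1) = max a (min (a + D)
          (x t - D / √2 / √(∑ i ∈ Finset.Icc 1 t, g i ^ 2) * g t)))
      ∧ (∑ i ∈ Finset.Icc 1 t, g i ^ 2 ≤ 0 → x (t + 1) = x t)) :
    ∑ t ∈ Finset.Icc 1 T, g t * (x t - y) ≤ √2 * D * √(∑ t ∈ Finset.Icc 1 T, g t ^ 2) := by
  have h2 : √2 ^ 2 = (2 : ℝ) := Real.sq_sqrt zero_le_two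
  have hη : 2 * (D / √2) ^ 2 = D ^ 2 := by rw [div_pow, h2]; ring
  have h := (adagrad_coordinate_potential hη hD.le hx1 hy hupdate T le_rfl).2
  have hpos : 0 < 2 * (D / √2) := by positivity
  refine le_of_mul_le_mul_left (h.trans ?_) hpos
  have hcoef : 2 * (D / √2) * (√2 * D * √(∑ t ∈ Finset.Icc 1 T, g t ^ 2))
      = √(∑ t ∈ Finset.Icc 1 T, g t ^ 2) * (2 * D ^ 2) := by field_simp
  rw [hcoef]
  gcongr
  linarith [sq_nonneg (x (T + 1) - y)]

/-- The first-order inequality for a convex function on `Fin d → ℝ`, in coordinates. -/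
lemma ConvexOn.sub_le_sum_partial_mul {d : ℕ} {f : (Fin d → ℝ) → ℝ}
    (hconv : ConvexOn ℝ Set.univ f) {x : Fin d → ℝ} (hdiff : DifferentiableAt ℝ f x)
    (y : Fin d → ℝ) :
    f x - f y ≤ ∑ j, fderiv ℝ f x (Pi.single j 1) * (x j - y j) := by
  have hline : HasDerivAt (fun t : ℝ => f (AffineMap.lineMap x y t))
      (fderiv ℝ f x (y - x)) 0 := by
    have h : HasFDerivAt f (fderiv ℝ f x) (AffineMap.lineMap x y (0 : ℝ)) := by
      simpa using hdiff.hasFDerivAt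
    exact h.comp_hasDerivAt 0 AffineMap.hasDerivAt_lineMap
  have hc : ConvexOn ℝ Set.univ (fun t : ℝ => f (AffineMap.lineMap x y t)) := by
    simpa [Function.comp_def] using hconv.comp_affineMap (AffineMap.lineMap x y : ℝ →ᵃ[ℝ] (Fin d → ℝ))
  have h := hc.le_slope_of_hasDerivAt (Set.mem_univ 0) (Set.mem_univ 1) one_pos hline
  simp only [slope_def_field, AffineMap.lineMap_apply_one, AffineMap.lineMap_apply_zero, sub_zero,
    div_one] at h
  have hsum : fderiv ℝ f x (y - x) = ∑ j, fderiv ℝ f x (Pi.single j 1) * (y j - x j) := by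
    conv_lhs => rw [pi_eq_sum_univ' (y - x)]
    simp [map_sum, mul_comm]
  rw [hsum] at h
  have hneg : ∑ j, fderiv ℝ f x (Pi.single j 1) * (x j - y j)
      = -∑ j, fderiv ℝ f x (Pi.single j 1) * (y j - x j) := by
    rw [← Finset.sum_neg_distrib]
    exact Finset.sum_congr rfl fun j _ => by ring
  linarith

/-- AdaGrad regret bound on a hypercube: for convex differentiable `f`, the
projected diagonal AdaGrad iterates with stepsize `η = D∞/√2` on the hypercube
`∏ⱼ [aⱼ, aⱼ + D∞]` satisfy, for every `x` in the hypercube,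
`∑_{t=1}^T (f(x_t) − f(x)) ≤ √(2 d D∞² ∑_{t=1}^T ‖∇f(x_t)‖²)`. -/
theorem stmt2 (d T : ℕ) (a : Fin d → ℝ) (Dinf : ℝ) (hD : 0 < Dinf)
    (f : (Fin d → ℝ) → ℝ)
    (hconv : ConvexOn ℝ Set.univ f) (hdiff : Differentiable ℝ f)
    (x : ℕ → Fin d → ℝ)
    (hx1 : ∀ j, x 1 j ∈ Set.Icc (a j) (a j + Dinf))
    (η : ℝ) (hη : η = Dinf / Real.sqrt 2)
    (G : ℕ → Fin d → ℝ)
    (hG : ∀ t j, G t j = fderiv ℝ f (x t) (Pi.single j 1))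
    (hupdate : ∀ t ∈ Finset.Icc 1 T, ∀ j : Fin d,
      (0 < ∑ i ∈ Finset.Icc 1 t, (G i j) ^ 2 →
        x (t + 1) j = max (a j) (min (a j + Dinf)
          (x t j - η / Real.sqrt (∑ i ∈ Finset.Icc 1 t, (G i j) ^ 2) * G t j)))
      ∧ (∑ i ∈ Finset.Icc 1 t, (G i j) ^ 2 ≤ 0 → x (t + 1) j = x t j)) :
    ∀ y : Fin d → ℝ, (∀ j, y j ∈ Set.Icc (a j) (a j + Dinf)) →
      ∑ t ∈ Finset.Icc 1 T, (f (x t) - f y)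
        ≤ Real.sqrt (2 * d * Dinf ^ 2 * ∑ t ∈ Finset.Icc 1 T, ∑ j : Fin d, (G t j) ^ 2) := by
  intro y hy
  subst hη
  have hlin : ∀ t, f (x t) - f y ≤ ∑ j, G t j * (x t j - y j) := fun t => by
    simpa only [hG] using hconv.sub_le_sum_partial_mul (hdiff (x t)) y
  have hcoord : ∀ j, ∑ t ∈ Finset.Icc 1 T, G t j * (x t j - y j)
      ≤ √2 * Dinf * √(∑ t ∈ Finset.Icc 1 T, G t j ^ 2) := fun j =>
    adagrad_coordinate_regret (x := fun t => x t j) (g := fun t => G t j) hD (hx1 j) (hy j)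
      fun t ht => hupdate t ht j
  have hS : ∀ j, 0 ≤ ∑ t ∈ Finset.Icc 1 T, G t j ^ 2 := fun j =>
    Finset.sum_nonneg fun t _ => sq_nonneg _
  calc ∑ t ∈ Finset.Icc 1 T, (f (x t) - f y)
      ≤ ∑ t ∈ Finset.Icc 1 T, ∑ j, G t j * (x t j - y j) :=
        Finset.sum_le_sum fun t _ => hlin t
    _ = ∑ j, ∑ t ∈ Finset.Icc 1 T, G t j * (x t j - y j) := Finset.sum_comm
    _ ≤ ∑ j, √2 * Dinf * √(∑ t ∈ Finset.Icc 1 T, G t j ^ 2) :=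
        Finset.sum_le_sum fun j _ => hcoord j
    _ = √2 * Dinf * ∑ j, √(∑ t ∈ Finset.Icc 1 T, G t j ^ 2) := by rw [Finset.mul_sum]
    _ ≤ _ := by
        apply Real.le_sqrt_of_sq_le
        have hcs := sq_sum_le_card_mul_sum_sq (s := Finset.univ)
          (f := fun j => √(∑ t ∈ Finset.Icc 1 T, G t j ^ 2))
        simp only [Real.sq_sqrt (hS _), Finset.card_univ, Fintype.card_fin] at hcs
        rw [Finset.sum_comm] at hcs
        rw [mul_pow, mul_pow, Real.sq_sqrt zero_le_two]
        calc 2 * Dinf ^ 2 * (∑ j, √(∑ t ∈ Finset.Icc 1 T, G t j ^ 2)) ^ 2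
            ≤ 2 * Dinf ^ 2 * (d * ∑ t ∈ Finset.Icc 1 T, ∑ j, G t j ^ 2) := by gcongr
          _ = _ := by ring
end

section
/- Let f : ℝ^d → ℝ be differentiable, μ-strongly convex and M-smooth (i.e., ∇f is M-Lipschitz) with unique minimizer x*. Let x₀ ∈ ℝ^d with ‖x₀ − x*‖∞ ≤ D∞. Set T = ⌈32 d M/μ⌉ and x̄₀ = x₀. For i = 1,…,N, let x̄_i be the average (1/T)∑_{t=1}^T x_t of T iterates of projected diagonal AdaGrad (coordinate-wise update x_{t+1,j} = Π_{K_i,j}( x_{t,j} − (η_i / √(∑_{s=1}^t (∂_j f(x_s))²)) ∂_j f(x_t) ), clamping each coordinate to K_i) started at x₁ = x̄_{i−1}, with constraint hypercube K_i = { x : ‖x − x̄_{i−1}‖∞ ≤ D∞/2^{i−1} } and stepsize η_i equal to the ℓ∞-diameter of K_i divided by √2, i.e., η_i = (2·D∞/2^{i−1})/√2. Then ‖x̄_N − x*‖∞² ≤ D∞²/4^N. Consequently, to obtain a point x with ‖x − x*‖∞² ≤ ε it suffices to make at most ⌈32 d M/μ⌉ · ⌈log₄(D∞²/ε)⌉ gradient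 evaluations. -/
open Finset in
/-- Regret bound for one coordinate of projected AdaGrad on the interval `[l, r]`. -/
theorem adagrad_regret_coordinate (l r u η : ℝ) (hη : 0 < η) (hlu : l ≤ u) (hur : u ≤ r)
    (x g : ℕ → ℝ) (T : ℕ) (hl : l ≤ x 1) (hr : x 1 ≤ r)
    (hupdate : ∀ t ∈ Icc 1 T, x (t + 1) =
      max l (min r (x t - η / √(∑ s ∈ Icc 1 t, g s ^ 2) * g t))) :
    ∑ t ∈ Icc 1 T, g t * (x t - u) ≤
      √(∑ t ∈ Icc 1 T, g t ^ 2) *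
        (((r - l) ^ 2 - (x (T + 1) - u) ^ 2) / (2 * η) + η) := by
  induction T with
  | zero => simp
  | succ n ih =>
    have ih' := ih fun t ht => hupdate t (Icc_subset_Icc_right n.le_succ ht)
    have hstep := hupdate (n + 1) (by simp)
    have hmem : l ≤ x (n + 1) ∧ x (n + 1) ≤ r := by
      rcases Nat.eq_zero_or_pos n with rfl | hn
      · exact ⟨hl, hr⟩
      · rw [hupdate n (by simp; omega)]
        exact ⟨le_max_left _ _, max_le (hlu.trans hur) (min_le_left _ _)⟩
    rw [sum_Icc_succ_top (by omega : 1 ≤ n + 1)] at hstep ⊢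
    rw [sum_Icc_succ_top (by omega : 1 ≤ n + 1) (fun t => g t ^ 2)]
    have hG : 0 ≤ ∑ t ∈ Icc 1 n, g t ^ 2 := sum_nonneg fun _ _ => sq_nonneg _
    set a := √(∑ t ∈ Icc 1 n, g t ^ 2) with ha
    set b := √(∑ t ∈ Icc 1 n, g t ^ 2 + g (n + 1) ^ 2) with hb
    have ha0 : 0 ≤ a := Real.sqrt_nonneg _
    have hab : a ≤ b := Real.sqrt_le_sqrt (by linarith [sq_nonneg (g (n + 1))])
    have ha2 : a ^ 2 = ∑ t ∈ Icc 1 n, g t ^ 2 := Real.sq_sqrt hG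
    have hb2 : b ^ 2 = a ^ 2 + g (n + 1) ^ 2 := by
      rw [ha2]; exact Real.sq_sqrt (by positivity)
    clear_value a b
    set γ := g (n + 1)
    set y := x (n + 1)
    set z := x (n + 1 + 1)
    have hproj : (z - u) ^ 2 ≤ (y - η / b * γ - u) ^ 2 := by
      rw [hstep]
      apply sq_le_sq.2
      rcases le_total r (y - η / b * γ) with h | h
      · rw [min_eq_left h, max_eq_right (hlu.trans hur), abs_of_nonneg (by linarith),
          abs_of_nonneg (by linarith)]
        linarith
      · rw [min_eq_right h]
        rcases le_total l (y - η / b * γ) with h' | h'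
        · rw [max_eq_right h']
        · rw [max_eq_left h', abs_of_nonpos (by linarith), abs_of_nonpos (by linarith)]
          linarith
    have hdiam : (y - u) ^ 2 ≤ (r - l) ^ 2 :=
      sq_le_sq.2 (by rw [abs_le]; constructor <;> linarith [le_abs_self (r - l)])
    have hmono : a * (((r - l) ^ 2 - (y - u) ^ 2) / (2 * η)) ≤
        b * (((r - l) ^ 2 - (y - u) ^ 2) / (2 * η)) :=
      mul_le_mul_of_nonneg_right hab (div_nonneg (by linarith) (by linarith))
    have hgain : γ * (y - u) ≤
        b * (((y - u) ^ 2 - (z - u) ^ 2) / (2 * η)) + η * (b - a) := by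
      rcases (ha0.trans hab).eq_or_lt with h0 | hbpos
      · have hγ : γ = 0 := by
          have : γ ^ 2 ≤ 0 := by rw [← h0] at hb2; nlinarith [sq_nonneg a]
          exact pow_eq_zero_iff two_ne_zero |>.1 (le_antisymm this (sq_nonneg _))
        rw [hγ, ← h0]
        nlinarith
      · have hsq : b * ((y - u) ^ 2 - (y - η / b * γ - u) ^ 2) / (2 * η) =
            γ * (y - u) - η * (γ ^ 2 / (2 * b)) := by
          field_simp
          ring
        have hle : b * ((y - u) ^ 2 - (y - η / b * γ - u) ^ 2) / (2 * η) ≤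
            b * ((y - u) ^ 2 - (z - u) ^ 2) / (2 * η) := by gcongr
        have hquot : γ ^ 2 / (2 * b) ≤ b - a := by
          rw [div_le_iff₀ (by positivity)]
          nlinarith [sq_nonneg (b - a)]
        have := mul_le_mul_of_nonneg_left hquot hη.le
        rw [← mul_div_assoc]
        linarith
    calc _ ≤ a * (((r - l) ^ 2 - (y - u) ^ 2) / (2 * η) + η) +
          (b * (((y - u) ^ 2 - (z - u) ^ 2) / (2 * η)) + η * (b - a)) := add_le_add ih' hgain
      _ ≤ b * (((r - l) ^ 2 - (y - u) ^ 2) / (2 * η)) + η * a +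
          (b * (((y - u) ^ 2 - (z - u) ^ 2) / (2 * η)) + η * (b - a)) := by linarith
      _ = _ := by ring

section Gradient

variable {E : Type*} [NormedAddCommGroup E] [InnerProductSpace ℝ E] [CompleteSpace E]

theorem hasDerivAt_comp_add_smul_gradient {f : E → ℝ} (hf : Differentiable ℝ f) (x v : E)
    (s : ℝ) : HasDerivAt (fun s : ℝ => f (x + s • v)) (inner ℝ (gradient f (x + s • v)) v) s := by
  have hline : HasDerivAt (fun s : ℝ => x + s • v) v s := by
    simpa using ((hasDerivAt_id s).smul_const v).const_add x
  have := (hf (x + s • v)).hasGradientAt.hasFDerivAt.comp_hasDerivAt s hline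
  rwa [InnerProductSpace.toDual_apply_apply] at this

/-- The first-order characterization of strong convexity. -/
theorem add_inner_gradient_le_of_strongly_convex {f : E → ℝ} (hf : Differentiable ℝ f) {μ : ℝ}
    (hstrong : ∀ (x y : E) (s : ℝ), 0 ≤ s → s ≤ 1 →
      f (s • x + (1 - s) • y) ≤ s * f x + (1 - s) * f y - μ / 2 * s * (1 - s) * ‖x - y‖ ^ 2)
    (x y : E) :
    f x + inner ℝ (gradient f x) (y - x) + μ / 2 * ‖y - x‖ ^ 2 ≤ f y := by
  have hderiv := hasDerivAt_comp_add_smul_gradient hf x (y - x) 0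
  have hslope := hderiv.tendsto_slope_zero_right
  simp only [zero_add, zero_smul, add_zero, smul_eq_mul] at hslope
  have hbound : Filter.Tendsto (fun s : ℝ => f y - f x - μ / 2 * (1 - s) * ‖y - x‖ ^ 2)
      (nhdsWithin 0 (Set.Ioi 0)) (nhds (f y - f x - μ / 2 * (1 - 0) * ‖y - x‖ ^ 2)) :=
    (Continuous.tendsto (by fun_prop) 0).mono_left nhdsWithin_le_nhds
  have := le_of_tendsto_of_tendsto hslope hbound <| by
    filter_upwards [Ioc_mem_nhdsGT (zero_lt_one' ℝ)] with s hs
    have h := hstrong y x s hs.1.le hs.2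
    rw [show s • y + (1 - s) • x = x + s • (y - x) by module] at h
    rw [inv_mul_le_iff₀ hs.1]
    linarith
  linarith

/-- The descent lemma for functions with Lipschitz gradient. -/
theorem le_add_inner_gradient_of_smooth {f : E → ℝ} (hf : Differentiable ℝ f) {M : ℝ}
    (hsmooth : ∀ x y : E, ‖gradient f x - gradient f y‖ ≤ M * ‖x - y‖) (x v : E) :
    f (x + v) ≤ f x + inner ℝ (gradient f x) v + M / 2 * ‖v‖ ^ 2 := by
  set h : ℝ → ℝ := fun s => f (x + s • v) - (s * inner ℝ (gradient f x) v +
    M / 2 * ‖v‖ ^ 2 * s ^ 2) with hh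
  have hderiv (s : ℝ) : HasDerivAt h (inner ℝ (gradient f (x + s • v)) v -
      (inner ℝ (gradient f x) v + M / 2 * ‖v‖ ^ 2 * (2 * s))) s := by
    refine (hasDerivAt_comp_add_smul_gradient hf x v s).sub (HasDerivAt.add ?_ ?_)
    · simpa using (hasDerivAt_id s).mul_const (inner ℝ (gradient f x) v)
    · simpa using (hasDerivAt_pow 2 s).const_mul (M / 2 * ‖v‖ ^ 2)
  have hanti : AntitoneOn h (Set.Ici 0) := by
    refine antitoneOn_of_deriv_nonpos (convex_Ici 0)
      (fun s _ => (hderiv s).continuousAt.continuousWithinAt)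
      (fun s _ => (hderiv s).differentiableAt.differentiableWithinAt) fun s hs => ?_
    rw [interior_Ici] at hs
    have hs : 0 < s := hs
    rw [(hderiv s).deriv]
    have h₁ := real_inner_le_norm (gradient f (x + s • v) - gradient f x) v
    have h₂ := hsmooth (x + s • v) x
    rw [add_sub_cancel_left, norm_smul, Real.norm_of_nonneg hs.le] at h₂
    have h₃ := mul_le_mul_of_nonneg_right h₂ (norm_nonneg v)
    rw [inner_sub_left] at h₁
    linarith
  have := hanti (Set.mem_Ici.2 le_rfl) (Set.mem_Ici.2 zero_le_one) zero_le_one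
  simp only [hh, one_smul, zero_smul, add_zero] at this
  linarith

theorem gradient_eq_zero_of_forall_le {f : E → ℝ} {a : E} (hmin : ∀ x, f a ≤ f x) :
    gradient f a = 0 := by
  have : IsLocalMin f a := Filter.Eventually.of_forall hmin
  rw [gradient, this.fderiv_eq_zero, map_zero]

/-- Cocoercivity of the gradient of a convex smooth function, relative to a critical point. -/
theorem norm_gradient_sq_le_of_smooth {f : E → ℝ} (hf : Differentiable ℝ f) {M : ℝ} (hM : 0 < M)
    (hsmooth : ∀ x y : E, ‖gradient f x - gradient f y‖ ≤ M * ‖x - y‖)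
    (hconvex : ∀ x y : E, f x + inner ℝ (gradient f x) (y - x) ≤ f y)
    {a : E} (hmin : ∀ x, f a ≤ f x) (x : E) :
    ‖gradient f x‖ ^ 2 ≤ M * inner ℝ (gradient f x) (x - a) := by
  have hdown := le_add_inner_gradient_of_smooth hf hsmooth x (-(M⁻¹ • gradient f x))
  have hup := le_add_inner_gradient_of_smooth hf hsmooth a (M⁻¹ • gradient f x)
  have hge := hconvex x (a + M⁻¹ • gradient f x)
  have hmin' := hmin (x + -(M⁻¹ • gradient f x))
  rw [show a + M⁻¹ • gradient f x - x = M⁻¹ • gradient f x - (x - a) by abel, inner_sub_right,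
    inner_smul_right, real_inner_self_eq_norm_sq] at hge
  rw [inner_neg_right, inner_smul_right, real_inner_self_eq_norm_sq, norm_neg] at hdown
  rw [gradient_eq_zero_of_forall_le hmin, inner_zero_left] at hup
  have hnorm : M / 2 * ‖M⁻¹ • gradient f x‖ ^ 2 = M⁻¹ * ‖gradient f x‖ ^ 2 / 2 := by
    rw [norm_smul, Real.norm_of_nonneg (by positivity)]
    field_simp
  rw [hnorm] at hdown hup
  rw [← inv_mul_le_iff₀ hM]
  linarith

end Gradient

open Finset in
/-- One round of projected AdaGrad on a hypercube centered at `c` halves the `ℓ∞`-distance to the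
minimizer. -/
theorem adagrad_round_sq_le {d : ℕ} {μ M : ℝ} (hμ : 0 < μ) (hM : 0 < M)
    (grad : EuclideanSpace ℝ (Fin d) → EuclideanSpace ℝ (Fin d)) (a : EuclideanSpace ℝ (Fin d))
    (hmono : ∀ x, μ * ‖x - a‖ ^ 2 ≤ inner ℝ (grad x) (x - a))
    (hcoco : ∀ x, ‖grad x‖ ^ 2 ≤ M * inner ℝ (grad x) (x - a))
    (c : EuclideanSpace ℝ (Fin d)) {R : ℝ} (hR : 0 < R) (hc : ∀ j, |c j - a j| ≤ R)
    {T : ℕ} (hT : 32 * d * M ≤ T * μ) (x : ℕ → EuclideanSpace ℝ (Fin d)) (hx1 : x 1 = c)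
    (hupdate : ∀ t ∈ Icc 1 T, ∀ j, x (t + 1) j = max (c j - R) (min (c j + R)
      (x t j - 2 * R / √2 / √(∑ s ∈ Icc 1 t, grad (x s) j ^ 2) * grad (x t) j)))
    (j : Fin d) :
    ((1 / (T : ℝ)) * ∑ t ∈ Icc 1 T, x t j - a j) ^ 2 ≤ (R / 2) ^ 2 := by
  have hd : 0 < (d : ℝ) := by exact_mod_cast j.pos
  have hTpos : 0 < (T : ℝ) := by
    have : 0 < (T : ℝ) * μ := lt_of_lt_of_le (by positivity) hT
    exact pos_of_mul_pos_left this hμ.le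
  have h2 : √2 ^ 2 = (2 : ℝ) := Real.sq_sqrt (by norm_num)
  set P := ∑ t ∈ Icc 1 T, inner ℝ (grad (x t)) (x t - a) with hP
  set A := ∑ k, √(∑ t ∈ Icc 1 T, grad (x t) k ^ 2) with hA
  have hA0 : 0 ≤ A := sum_nonneg fun _ _ => Real.sqrt_nonneg _
  have hPA : P ≤ 2 * √2 * R * A := by
    have hPsum : P = ∑ k, ∑ t ∈ Icc 1 T, grad (x t) k * (x t k - a k) := by
      rw [hP, sum_comm]
      refine sum_congr rfl fun t _ => ?_
      simp [PiLp.inner_apply, mul_comm]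
    rw [hPsum, hA, mul_sum]
    refine sum_le_sum fun k _ => ?_
    have hk := abs_le.1 (hc k)
    have hreg := adagrad_regret_coordinate (c k - R) (c k + R) (a k) (2 * R / √2)
      (by positivity) (by linarith) (by linarith) (fun t => x t k) (fun t => grad (x t) k) T
      (by simp only [hx1]; linarith) (by simp only [hx1]; linarith)
      (fun t ht => hupdate t ht k)
    refine hreg.trans ?_
    rw [mul_comm]
    refine mul_le_mul_of_nonneg_right ?_ (Real.sqrt_nonneg _)
    calc _ ≤ (c k + R - (c k - R)) ^ 2 / (2 * (2 * R / √2)) + 2 * R / √2 := by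
          gcongr
          linarith [sq_nonneg (x (T + 1) k - a k)]
      _ = 2 * √2 * R := by
          field_simp
          rw [h2]
          ring
  have hAP : A ^ 2 ≤ d * (M * P) := by
    calc A ^ 2 ≤ d * ∑ k, √(∑ t ∈ Icc 1 T, grad (x t) k ^ 2) ^ 2 := by
          simpa using sq_sum_le_card_mul_sum_sq (s := univ)
            (f := fun k : Fin d => √(∑ t ∈ Icc 1 T, grad (x t) k ^ 2))
      _ = d * ∑ t ∈ Icc 1 T, ‖grad (x t)‖ ^ 2 := by
          simp only [EuclideanSpace.real_norm_sq_eq]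
          rw [sum_comm]
          congr 1
          exact sum_congr rfl fun k _ => Real.sq_sqrt (sum_nonneg fun _ _ => sq_nonneg _)
      _ ≤ d * (M * P) := by
          rw [hP, mul_sum _ _ M]
          exact mul_le_mul_of_nonneg_left (sum_le_sum fun t _ => hcoco _) hd.le
  have hPmono : μ * ∑ t ∈ Icc 1 T, ‖x t - a‖ ^ 2 ≤ P := by
    rw [mul_sum]
    exact sum_le_sum fun t _ => hmono _
  have hP0 : 0 ≤ P := le_trans (by positivity) hPmono
  have hPle : P ≤ 8 * R ^ 2 * d * M := by
    rcases hP0.eq_or_lt with h0 | hPpos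
    · rw [← h0]
      positivity
    · have hsq : P ^ 2 ≤ 8 * R ^ 2 * A ^ 2 := by
        calc P ^ 2 ≤ (2 * √2 * R * A) ^ 2 := pow_le_pow_left₀ hP0 hPA 2
          _ = 8 * R ^ 2 * A ^ 2 := by rw [mul_pow, mul_pow, mul_pow, h2]; ring
      have := mul_le_mul_of_nonneg_left hAP (by positivity : 0 ≤ 8 * R ^ 2)
      refine le_of_mul_le_mul_right ?_ hPpos
      linarith
  have hjensen : (∑ t ∈ Icc 1 T, (x t j - a j)) ^ 2 ≤ T * ∑ t ∈ Icc 1 T, ‖x t - a‖ ^ 2 := by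
    calc (∑ t ∈ Icc 1 T, (x t j - a j)) ^ 2 ≤ T * ∑ t ∈ Icc 1 T, (x t j - a j) ^ 2 := by
          simpa using sq_sum_le_card_mul_sum_sq (s := Icc 1 T) (f := fun t => x t j - a j)
      _ ≤ _ := by
          refine mul_le_mul_of_nonneg_left (sum_le_sum fun t _ => ?_) hTpos.le
          rw [EuclideanSpace.real_norm_sq_eq]
          exact single_le_sum (f := fun k => (x t - a) k ^ 2) (fun _ _ => sq_nonneg _) (mem_univ j)
  have havg : (1 / (T : ℝ)) * ∑ t ∈ Icc 1 T, x t j - a j =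
      (∑ t ∈ Icc 1 T, (x t j - a j)) / T := by
    rw [sum_sub_distrib, sum_const, Nat.card_Icc, Nat.add_sub_cancel, nsmul_eq_mul]
    field_simp
  rw [havg, div_pow, div_le_iff₀ (by positivity)]
  refine hjensen.trans ?_
  have hsum : ∑ t ∈ Icc 1 T, ‖x t - a‖ ^ 2 ≤ (R / 2) ^ 2 * T := by
    refine le_of_mul_le_mul_left ?_ hμ
    have := mul_le_mul_of_nonneg_left hT (by positivity : 0 ≤ R ^ 2 / 4)
    linarith
  have := mul_le_mul_of_nonneg_left hsum hTpos.le
  linarith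

/-- AdaGrad with restarts: for a `μ`-strongly convex and `M`-smooth `f` with
minimizer `x*`, starting from `x₀` with `‖x₀ − x*‖∞ ≤ D∞`, running `N` rounds of projected
diagonal AdaGrad with `T = ⌈32 d M/μ⌉` iterations per round, constraint hypercube of
ℓ∞-radius `D∞/2^{i−1}` centered at the previous average, and stepsize
`η_i = (2 D∞/2^{i−1})/√2`, yields `‖x̄_N − x*‖∞² ≤ D∞²/4^N`; consequently
`N ≥ log₄(D∞²/ε)` rounds (i.e. at most `⌈32dM/μ⌉⌈log₄(D∞²/ε)⌉` gradient evaluations)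
suffice to reach `‖x̄_N − x*‖∞² ≤ ε`. -/
theorem stmt3 (d : ℕ) (μ M : ℝ) (hμ : 0 < μ)
    (f : EuclideanSpace ℝ (Fin d) → ℝ) (hdiff : Differentiable ℝ f)
    (hstrong : ∀ (x y : EuclideanSpace ℝ (Fin d)) (s : ℝ), 0 ≤ s → s ≤ 1 →
      f (s • x + (1 - s) • y) ≤ s * f x + (1 - s) * f y - μ / 2 * s * (1 - s) * ‖x - y‖ ^ 2)
    (hsmooth : ∀ x y : EuclideanSpace ℝ (Fin d),
      ‖gradient f x - gradient f y‖ ≤ M * ‖x - y‖)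
    (xstar : EuclideanSpace ℝ (Fin d)) (hmin : ∀ x, f xstar ≤ f x)
    (x0 : EuclideanSpace ℝ (Fin d)) (Dinf : ℝ) (hD : 0 < Dinf)
    (hx0 : ∀ j, |x0 j - xstar j| ≤ Dinf)
    (T : ℕ) (hT : T = ⌈32 * d * M / μ⌉₊)
    (N : ℕ)
    (xbar : ℕ → EuclideanSpace ℝ (Fin d)) (hxbar0 : xbar 0 = x0)
    (X : ℕ → ℕ → EuclideanSpace ℝ (Fin d))
    (hX1 : ∀ i ∈ Finset.Icc 1 N, X i 1 = xbar (i - 1))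
    (hupdate : ∀ i ∈ Finset.Icc 1 N, ∀ t ∈ Finset.Icc 1 T, ∀ j : Fin d,
      X i (t + 1) j
        = max (xbar (i - 1) j - Dinf / 2 ^ (i - 1))
            (min (xbar (i - 1) j + Dinf / 2 ^ (i - 1))
              (X i t j -
                (2 * Dinf / 2 ^ (i - 1) / Real.sqrt 2)
                  / Real.sqrt (∑ s ∈ Finset.Icc 1 t, (gradient f (X i s) j) ^ 2)
                  * gradient f (X i t) j)))
    (havg : ∀ i ∈ Finset.Icc 1 N, ∀ j : Fin d,
      xbar i j = (1 / (T : ℝ)) * ∑ t ∈ Finset.Icc 1 T, X i t j) :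
    (∀ j, (xbar N j - xstar j) ^ 2 ≤ Dinf ^ 2 / 4 ^ N)
    ∧ (∀ ε : ℝ, 0 < ε → Real.logb 4 (Dinf ^ 2 / ε) ≤ N →
        ∀ j, (xbar N j - xstar j) ^ 2 ≤ ε) := by
  have hfirst := add_inner_gradient_le_of_strongly_convex hdiff hstrong
  have hcrit := gradient_eq_zero_of_forall_le hmin
  have hmono (x : EuclideanSpace ℝ (Fin d)) :
      μ * ‖x - xstar‖ ^ 2 ≤ inner ℝ (gradient f x) (x - xstar) := by
    have h₁ := hfirst x xstar
    have h₂ := hfirst xstar x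
    rw [hcrit, inner_zero_left] at h₂
    rw [← neg_sub x xstar, inner_neg_right, norm_neg] at h₁
    linarith
  have hdist : ∀ k ≤ N, ∀ j, |xbar k j - xstar j| ≤ Dinf / 2 ^ k := by
    intro k
    induction k with
    | zero => simpa [hxbar0] using hx0
    | succ k ih =>
      intro hk j
      have hM : 0 < M := by
        have h₁ := hmono (xstar + EuclideanSpace.single j 1)
        have h₂ := real_inner_le_norm (gradient f (xstar + EuclideanSpace.single j 1))
          (xstar + EuclideanSpace.single j 1 - xstar)
        have h₃ := hsmooth (xstar + EuclideanSpace.single j 1) xstar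
        rw [hcrit, sub_zero] at h₃
        simp only [add_sub_cancel_left, PiLp.norm_single, norm_one] at h₁ h₂ h₃
        linarith
      have hconvex (x y : EuclideanSpace ℝ (Fin d)) :
          f x + inner ℝ (gradient f x) (y - x) ≤ f y := by
        have : 0 ≤ μ / 2 * ‖y - x‖ ^ 2 := by positivity
        linarith [hfirst x y]
      have hT' : 32 * d * M ≤ T * μ := by
        rw [← div_le_iff₀ hμ, hT]
        exact Nat.le_ceil _
      have hmem : k + 1 ∈ Finset.Icc 1 N := Finset.mem_Icc.2 ⟨by omega, hk⟩
      have hround := adagrad_round_sq_le hμ hM (gradient f) xstar hmono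
        (norm_gradient_sq_le_of_smooth hdiff hM hsmooth hconvex hmin) (xbar k)
        (by positivity : 0 < Dinf / 2 ^ k) (ih (by omega)) hT' (X (k + 1)) (hX1 _ hmem)
        (fun t ht j => by
          have := hupdate _ hmem t ht j
          rwa [Nat.add_sub_cancel, mul_div_assoc] at this) j
      rw [← havg _ hmem j] at hround
      rw [pow_succ, ← div_div]
      exact abs_le_of_sq_le_sq hround (by positivity)
  have hmain : ∀ j, (xbar N j - xstar j) ^ 2 ≤ Dinf ^ 2 / 4 ^ N := by
    intro j
    have := pow_le_pow_left₀ (abs_nonneg _) (hdist N le_rfl j) 2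
    rwa [sq_abs, div_pow, ← pow_mul, mul_comm N, pow_mul,
      show (2 : ℝ) ^ 2 = 4 by norm_num] at this
  refine ⟨hmain, fun ε hε hlog j => (hmain j).trans ?_⟩
  rw [Real.logb_le_iff_le_rpow (by norm_num) (by positivity), Real.rpow_natCast,
    div_le_iff₀ hε] at hlog
  rw [div_le_iff₀ (by positivity)]
  linarith
end

section
/- Let f : ℝ^d → ℝ be differentiable, μ-strongly convex and M-smooth with unique minimizer x*. Let K be a closed hypercube of ℓ∞-diameter D containing x*, and let x₁,…,x_T ∈ K be any points satisfying the regret bound ∑_{t=1}^T ( f(x_t) − f(x*) ) ≤ √( 2 d D² ∑_{t=1}^T ‖∇f(x_t)‖² ). Then the average x̄ = (1/T)∑_{t=1}^T x_t satisfies ‖x̄ − x*‖∞² ≤ 8 M d D² / (μ T). In particular, if T ≥ 32 d M/μ, then ‖x̄ − x*‖∞² ≤ D²/4. -/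
/-- The descent lemma: a function with `M`-Lipschitz gradient lies below its quadratic upper
model. -/
theorem le_quadratic_upper_model_of_lipschitz_gradient {E : Type*} [NormedAddCommGroup E]
    [InnerProductSpace ℝ E] [CompleteSpace E] {f : E → ℝ} {M : ℝ} (hdiff : Differentiable ℝ f)
    (hsmooth : ∀ x y, ‖gradient f x - gradient f y‖ ≤ M * ‖x - y‖) (x v : E) :
    f (x + v) ≤ f x + inner ℝ (gradient f x) v + M / 2 * ‖v‖ ^ 2 := by
  set φ : ℝ → ℝ := fun t ↦
    f (x + t • v) - t * inner ℝ (gradient f x) v - M / 2 * ‖v‖ ^ 2 * t ^ 2 with hφ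
  have hderiv (t : ℝ) : HasDerivAt φ (inner ℝ (gradient f (x + t • v)) v
      - inner ℝ (gradient f x) v - M * ‖v‖ ^ 2 * t) t := by
    have hline : HasDerivAt (fun t : ℝ ↦ x + t • v) v t := by
      simpa using ((hasDerivAt_id t).smul_const v).const_add x
    have hf : HasDerivAt (fun t : ℝ ↦ f (x + t • v)) (inner ℝ (gradient f (x + t • v)) v) t := by
      simpa [Function.comp_def] using
        (hdiff (x + t • v)).hasGradientAt.hasFDerivAt.comp_hasDerivAt t hline
    have hlin := (hasDerivAt_id t).mul_const (inner ℝ (gradient f x) v)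
    have hquad := (hasDerivAt_pow 2 t).const_mul (M / 2 * ‖v‖ ^ 2)
    refine ((hf.sub hlin).sub hquad).congr_deriv ?_
    push_cast
    ring
  have hanti : AntitoneOn φ (Set.Icc 0 1) := by
    refine antitoneOn_of_deriv_nonpos (convex_Icc 0 1)
      (fun t _ ↦ (hderiv t).continuousAt.continuousWithinAt)
      (fun t _ ↦ (hderiv t).differentiableAt.differentiableWithinAt) fun t ht ↦ ?_
    rw [interior_Icc] at ht
    rw [(hderiv t).deriv, ← inner_sub_left, sub_nonpos]
    calc inner ℝ (gradient f (x + t • v) - gradient f x) v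
        ≤ ‖gradient f (x + t • v) - gradient f x‖ * ‖v‖ := real_inner_le_norm _ _
      _ ≤ M * ‖x + t • v - x‖ * ‖v‖ := by gcongr; exact hsmooth _ _
      _ = M * ‖v‖ ^ 2 * t := by
        rw [add_sub_cancel_left, norm_smul, Real.norm_of_nonneg ht.1.le]
        ring
  have h01 := hanti (Set.left_mem_Icc.2 zero_le_one) (Set.right_mem_Icc.2 zero_le_one) zero_le_one
  simp only [hφ, one_smul, zero_smul, add_zero] at h01
  linarith

/-- Self-bounding property of smooth functions. -/
theorem sq_norm_gradient_le_of_lipschitz_gradient {E : Type*} [NormedAddCommGroup E]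
    [InnerProductSpace ℝ E] [CompleteSpace E] {f : E → ℝ} {M : ℝ} (hM : 0 ≤ M)
    (hdiff : Differentiable ℝ f)
    (hsmooth : ∀ x y, ‖gradient f x - gradient f y‖ ≤ M * ‖x - y‖) {z : E}
    (hmin : ∀ x, f z ≤ f x) (x : E) :
    ‖gradient f x‖ ^ 2 ≤ 2 * M * (f x - f z) := by
  rcases hM.eq_or_lt with rfl | hM
  · have hz : gradient f z = 0 := by
      have : IsLocalMin f z := Filter.Eventually.of_forall hmin
      simp [gradient, this.fderiv_eq_zero]
    have := hsmooth x z
    simp only [hz, sub_zero, zero_mul] at this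
    simp [norm_le_zero_iff.1 this]
  · have hdesc := le_quadratic_upper_model_of_lipschitz_gradient hdiff hsmooth x
      (-(M⁻¹ • gradient f x))
    rw [inner_neg_right, real_inner_smul_right, real_inner_self_eq_norm_sq, norm_neg, norm_smul,
      Real.norm_of_nonneg (inv_nonneg.2 hM.le)] at hdesc
    have hz := (hmin _).trans hdesc
    have hmodel : M / 2 * (M⁻¹ * ‖gradient f x‖) ^ 2 = M⁻¹ * ‖gradient f x‖ ^ 2 / 2 := by
      field_simp
    have hle : M⁻¹ * ‖gradient f x‖ ^ 2 ≤ 2 * (f x - f z) := by linarith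
    rw [inv_mul_le_iff₀ hM] at hle
    linarith

/-- Quadratic growth of strongly convex functions away from a minimizer. -/
theorem quadratic_growth_of_strongly_convex {E : Type*} [NormedAddCommGroup E]
    [NormedSpace ℝ E] {f : E → ℝ} {μ : ℝ}
    (hstrong : ∀ (x y : E) (s : ℝ), 0 ≤ s → s ≤ 1 →
      f (s • x + (1 - s) • y) ≤ s * f x + (1 - s) * f y - μ / 2 * s * (1 - s) * ‖x - y‖ ^ 2)
    {z : E} (hmin : ∀ x, f z ≤ f x) (x : E) :
    μ / 2 * ‖x - z‖ ^ 2 ≤ f x - f z := by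
  have hlim : Filter.Tendsto (fun s : ℝ ↦ μ / 2 * (1 - s) * ‖x - z‖ ^ 2) (nhdsWithin 0 (Set.Ioi 0))
      (nhds (μ / 2 * (1 - 0) * ‖x - z‖ ^ 2)) :=
    (Continuous.tendsto (by fun_prop) 0).mono_left nhdsWithin_le_nhds
  rw [sub_zero, mul_one] at hlim
  refine le_of_tendsto hlim ?_
  filter_upwards [Ioc_mem_nhdsGT (zero_lt_one' ℝ)] with s hs
  have hs' := (hmin _).trans (hstrong x z s hs.1.le hs.2)
  refine le_of_mul_le_mul_left ?_ hs.1
  linarith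


/-- single-round shrinkage: for a `μ`-strongly convex, `M`-smooth `f` with
minimizer `x*` in a hypercube `K` of ℓ∞-diameter `D`, any points `x₁,…,x_T ∈ K` satisfying
the AdaGrad regret bound have average `x̄` with `‖x̄ − x*‖∞² ≤ 8MdD²/(μT)`; in particular,
`T ≥ 32dM/μ` gives `‖x̄ − x*‖∞² ≤ D²/4`. -/
theorem stmt4 (d T : ℕ) (hT : 0 < T) (μ M D : ℝ) (hμ : 0 < μ) (hD : 0 < D)
    (f : EuclideanSpace ℝ (Fin d) → ℝ) (hdiff : Differentiable ℝ f)
    (hstrong : ∀ (x y : EuclideanSpace ℝ (Fin d)) (s : ℝ), 0 ≤ s → s ≤ 1 →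
      f (s • x + (1 - s) • y) ≤ s * f x + (1 - s) * f y - μ / 2 * s * (1 - s) * ‖x - y‖ ^ 2)
    (hsmooth : ∀ x y : EuclideanSpace ℝ (Fin d),
      ‖gradient f x - gradient f y‖ ≤ M * ‖x - y‖)
    (xstar : EuclideanSpace ℝ (Fin d)) (hmin : ∀ x, f xstar ≤ f x)
    (a : Fin d → ℝ)
    (hxstarK : ∀ j, xstar j ∈ Set.Icc (a j) (a j + D))
    (x : ℕ → EuclideanSpace ℝ (Fin d))
    (hxK : ∀ t ∈ Finset.Icc 1 T, ∀ j, x t j ∈ Set.Icc (a j) (a j + D))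
    (hregret : ∑ t ∈ Finset.Icc 1 T, (f (x t) - f xstar)
      ≤ Real.sqrt (2 * d * D ^ 2 * ∑ t ∈ Finset.Icc 1 T, ‖gradient f (x t)‖ ^ 2))
    (xbar : EuclideanSpace ℝ (Fin d))
    (hxbar : ∀ j, xbar j = (1 / (T : ℝ)) * ∑ t ∈ Finset.Icc 1 T, x t j) :
    (∀ j, (xbar j - xstar j) ^ 2 ≤ 8 * M * d * D ^ 2 / (μ * T))
    ∧ (32 * d * M / μ ≤ T → ∀ j, (xbar j - xstar j) ^ 2 ≤ D ^ 2 / 4) := by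
  have hT' : (0 : ℝ) < T := by exact_mod_cast hT
  have hbound : ∀ j, (xbar j - xstar j) ^ 2 ≤ 8 * M * d * D ^ 2 / (μ * T) := by
    intro j
    have hM : 0 ≤ M := by
      have h := (norm_nonneg _).trans (hsmooth (EuclideanSpace.single j 1) 0)
      simpa using h
    set S := ∑ t ∈ Finset.Icc 1 T, (f (x t) - f xstar) with hS
    have hS0 : 0 ≤ S := Finset.sum_nonneg fun t _ ↦ sub_nonneg.2 (hmin _)
    have hgrad : ∑ t ∈ Finset.Icc 1 T, ‖gradient f (x t)‖ ^ 2 ≤ 2 * M * S := by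
      rw [hS, Finset.mul_sum]
      exact Finset.sum_le_sum fun t _ ↦
        sq_norm_gradient_le_of_lipschitz_gradient hM hdiff hsmooth hmin (x t)
    have hsq : S ^ 2 ≤ 2 * d * D ^ 2 * (2 * M * S) := by
      refine ((Real.le_sqrt hS0 (by positivity)).1 hregret).trans ?_
      gcongr
    have hSle : S ≤ 4 * M * d * D ^ 2 := by
      rcases hS0.eq_or_lt with h0 | h0
      · rw [← h0]
        positivity
      · refine le_of_mul_le_mul_right ?_ h0
        linarith
    have hdev : T * (xbar j - xstar j) = ∑ t ∈ Finset.Icc 1 T, (x t j - xstar j) := by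
      rw [hxbar, Finset.sum_sub_distrib]
      simp
      field_simp
    have hcauchy : T * (xbar j - xstar j) ^ 2 ≤ ∑ t ∈ Finset.Icc 1 T, (x t j - xstar j) ^ 2 := by
      have h := sq_sum_le_card_mul_sum_sq (s := Finset.Icc 1 T) (f := fun t ↦ x t j - xstar j)
      rw [← hdev, Nat.card_Icc, Nat.add_sub_cancel] at h
      refine le_of_mul_le_mul_left ?_ hT'
      linarith
    have hgrowth : μ / 2 * ∑ t ∈ Finset.Icc 1 T, (x t j - xstar j) ^ 2 ≤ S := by
      rw [hS, Finset.mul_sum]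
      refine Finset.sum_le_sum fun t _ ↦
        le_trans ?_ (quadratic_growth_of_strongly_convex hstrong hmin (x t))
      have h := PiLp.norm_apply_le (x t - xstar) j
      rw [PiLp.sub_apply, Real.norm_eq_abs] at h
      rw [← sq_abs]
      gcongr
    rw [le_div_iff₀ (by positivity)]
    have := mul_le_mul_of_nonneg_left hcauchy hμ.le
    linarith
  refine ⟨hbound, fun hlarge j ↦ (hbound j).trans ?_⟩
  rw [div_le_iff₀ hμ] at hlarge
  rw [div_le_iff₀ (by positivity)]
  have := mul_le_mul_of_nonneg_left hlarge (sq_nonneg D)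
  linarith
end

section
/- Let f : ℝ^d → ℝ be differentiable, convex, and M-smooth (∇f is M-Lipschitz with respect to the Euclidean norm), with global minimizer x*. Suppose the points x₁,…,x_T satisfy ∑_{t=1}^T ( f(x_t) − f(x*) ) ≤ √( 2 d D² ∑_{t=1}^T ‖∇f(x_t)‖² ) for some D > 0. Then ∑_{t=1}^T ( f(x_t) − f(x*) ) ≤ 4 M d D². -/
open scoped InnerProductSpace in
/-- The quadratic upper bound of a function with `M`-Lipschitz gradient. -/
theorem le_quadratic_of_gradient_lipschitz {E : Type*} [NormedAddCommGroup E]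
    [InnerProductSpace ℝ E] [CompleteSpace E] {f : E → ℝ} {M : ℝ} (hf : Differentiable ℝ f)
    (hM : ∀ x y : E, ‖gradient f x - gradient f y‖ ≤ M * ‖x - y‖) (x v : E) :
    f (x + v) ≤ f x + ⟪gradient f x, v⟫_ℝ + M / 2 * ‖v‖ ^ 2 := by
  have hder : ∀ t : ℝ, HasDerivAt (fun t : ℝ => f (x + t • v)) ⟪gradient f (x + t • v), v⟫_ℝ t := by
    intro t
    have hline : HasDerivAt (fun t : ℝ => x + t • v) v t := by
      simpa using ((hasDerivAt_id t).smul_const v).const_add x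
    have hgrad := (hf (x + t • v)).hasGradientAt.hasFDerivAt
    simpa [Function.comp_def] using hgrad.comp_hasDerivAt t hline
  have hbound : ∀ t : ℝ, HasDerivAt
      (fun t : ℝ => f x + t * ⟪gradient f x, v⟫_ℝ + M / 2 * ‖v‖ ^ 2 * t ^ 2)
      (⟪gradient f x, v⟫_ℝ + M * ‖v‖ ^ 2 * t) t := by
    intro t
    have hlin := ((hasDerivAt_id t).mul_const ⟪gradient f x, v⟫_ℝ).const_add (f x)
    have hquad := ((hasDerivAt_id t).pow 2).const_mul (M / 2 * ‖v‖ ^ 2)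
    refine (hlin.add hquad).congr_deriv ?_
    simp
    ring
  have hle := image_le_of_deriv_right_le_deriv_boundary (a := 0) (b := 1)
    (fun t _ => (hder t).continuousAt.continuousWithinAt)
    (fun t _ => (hder t).hasDerivWithinAt) (by simp)
    (fun t _ => (hbound t).continuousAt.continuousWithinAt)
    (fun t _ => (hbound t).hasDerivWithinAt)
    (fun t ht => ?_) (Set.right_mem_Icc.2 zero_le_one)
  · simpa using hle
  · have hcs := real_inner_le_norm (gradient f (x + t • v) - gradient f x) v
    have hlip := hM (x + t • v) x
    rw [add_sub_cancel_left, norm_smul, Real.norm_of_nonneg ht.1] at hlip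
    rw [inner_sub_left] at hcs
    nlinarith [mul_le_mul_of_nonneg_right hlip (norm_nonneg v)]

/-- Self-bounding property: the gradient of a smooth function is controlled by its gap to the
minimum. -/
theorem norm_gradient_sq_le_of_gradient_lipschitz {E : Type*} [NormedAddCommGroup E]
    [InnerProductSpace ℝ E] [CompleteSpace E] {f : E → ℝ} {M : ℝ} (hM₀ : 0 ≤ M)
    (hf : Differentiable ℝ f)
    (hM : ∀ x y : E, ‖gradient f x - gradient f y‖ ≤ M * ‖x - y‖)
    {z : E} (hz : ∀ x, f z ≤ f x) (x : E) :
    ‖gradient f x‖ ^ 2 ≤ 2 * M * (f x - f z) := by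
  rcases hM₀.eq_or_lt with rfl | hpos
  · have hz' : gradient f z = 0 := by
      have hmin : IsLocalMin f z := Filter.Eventually.of_forall hz
      simp [gradient, hmin.fderiv_eq_zero]
    have hx := hM x z
    rw [hz', sub_zero, zero_mul] at hx
    simp [norm_le_zero_iff.1 hx]
  · have hle := (hz _).trans
      (le_quadratic_of_gradient_lipschitz hf hM x (-(M⁻¹ • gradient f x)))
    rw [inner_neg_right, real_inner_smul_right, real_inner_self_eq_norm_sq, norm_neg, norm_smul,
      Real.norm_of_nonneg (inv_nonneg.2 hM₀)] at hle
    have hgap : M⁻¹ * ‖gradient f x‖ ^ 2 / 2 ≤ f x - f z := by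
      have hsq : M / 2 * (M⁻¹ * ‖gradient f x‖) ^ 2 = M⁻¹ * ‖gradient f x‖ ^ 2 / 2 := by
        field_simp
      linarith
    calc ‖gradient f x‖ ^ 2 = 2 * M * (M⁻¹ * ‖gradient f x‖ ^ 2 / 2) := by field_simp
      _ ≤ 2 * M * (f x - f z) := by gcongr


/-- for convex `M`-smooth `f` with minimizer `x*`, if
`∑_{t=1}^T (f(x_t) − f(x*)) ≤ √(2dD² ∑_t ‖∇f(x_t)‖²)` then
`∑_{t=1}^T (f(x_t) − f(x*)) ≤ 4MdD²`. -/
theorem stmt5 (d T : ℕ) (M D : ℝ) (hD : 0 < D)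
    (f : EuclideanSpace ℝ (Fin d) → ℝ) (hdiff : Differentiable ℝ f)
    (hconv : ConvexOn ℝ Set.univ f)
    (hsmooth : ∀ x y : EuclideanSpace ℝ (Fin d),
      ‖gradient f x - gradient f y‖ ≤ M * ‖x - y‖)
    (xstar : EuclideanSpace ℝ (Fin d)) (hmin : ∀ x, f xstar ≤ f x)
    (x : ℕ → EuclideanSpace ℝ (Fin d))
    (hregret : ∑ t ∈ Finset.Icc 1 T, (f (x t) - f xstar)
      ≤ Real.sqrt (2 * d * D ^ 2 * ∑ t ∈ Finset.Icc 1 T, ‖gradient f (x t)‖ ^ 2)) :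
    ∑ t ∈ Finset.Icc 1 T, (f (x t) - f xstar) ≤ 4 * M * d * D ^ 2 := by
  rcases Nat.eq_zero_or_pos d with rfl | hd
  · simpa using hregret
  have hM₀ : 0 ≤ M := by
    have hnorm := hsmooth (EuclideanSpace.single ⟨0, hd⟩ 1) 0
    rw [sub_zero (EuclideanSpace.single _ _), PiLp.norm_single, norm_one, mul_one]
      at hnorm
    exact (norm_nonneg _).trans hnorm
  have hsum : ∑ t ∈ Finset.Icc 1 T, ‖gradient f (x t)‖ ^ 2
      ≤ 2 * M * ∑ t ∈ Finset.Icc 1 T, (f (x t) - f xstar) := by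
    rw [Finset.mul_sum]
    exact Finset.sum_le_sum fun t _ =>
      norm_gradient_sq_le_of_gradient_lipschitz hM₀ hdiff hsmooth hmin (x t)
  have hS : 0 ≤ ∑ t ∈ Finset.Icc 1 T, (f (x t) - f xstar) :=
    Finset.sum_nonneg fun t _ => sub_nonneg.2 (hmin _)
  generalize ∑ t ∈ Finset.Icc 1 T, (f (x t) - f xstar) = S at *
  rcases hS.eq_or_lt with rfl | hpos
  · positivity
  refine le_of_mul_le_mul_right ?_ hpos
  calc S * S = S ^ 2 := (sq S).symm
    _ ≤ 2 * d * D ^ 2 * ∑ t ∈ Finset.Icc 1 T, ‖gradient f (x t)‖ ^ 2 :=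
      (Real.le_sqrt' hpos).1 hregret
    _ ≤ 2 * d * D ^ 2 * (2 * M * S) := by gcongr
    _ = 4 * M * d * D ^ 2 * S := by ring
end

section
/- Let a₁,…,a_T be nonnegative real numbers. Then ∑_{t=1}^T a_t / √(∑_{i=1}^t a_i) ≤ 2 √( ∑_{t=1}^T a_t ), where a term with ∑_{i=1}^t a_i = 0 is interpreted as 0. -/
theorem two_mul_sqrt_add_div_sqrt_add_le {s x : ℝ} (hs : 0 ≤ s) (hx : 0 ≤ x) :
    2 * Real.sqrt s + x / Real.sqrt (s + x) ≤ 2 * Real.sqrt (s + x) := by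
  have huv : Real.sqrt s ≤ Real.sqrt (s + x) := Real.sqrt_le_sqrt (by linarith)
  have hu := Real.sq_sqrt hs
  have hv := Real.sq_sqrt (add_nonneg hs hx)
  rcases (Real.sqrt_nonneg (s + x)).eq_or_lt with h | h
  · rw [← h] at huv ⊢
    simp only [div_zero]
    linarith
  · have key : x / Real.sqrt (s + x) ≤ 2 * (Real.sqrt (s + x) - Real.sqrt s) := by
      rw [div_le_iff₀ h]
      nlinarith [sq_nonneg (Real.sqrt (s + x) - Real.sqrt s)]
    linarith

/-- McMahan–Streeter summation lemma: for nonnegative `a₁,…,a_T`,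
`∑_{t=1}^T a_t / √(∑_{i=1}^t a_i) ≤ 2√(∑_{t=1}^T a_t)` (terms with zero denominator are 0,
which is Lean's division-by-zero convention). -/
theorem stmt8 (T : ℕ) (a : ℕ → ℝ) (ha : ∀ t, 0 ≤ a t) :
    ∑ t ∈ Finset.Icc 1 T, a t / Real.sqrt (∑ i ∈ Finset.Icc 1 t, a i)
      ≤ 2 * Real.sqrt (∑ t ∈ Finset.Icc 1 T, a t) := by
  induction T with
  | zero => simp
  | succ n ih =>
    rw [Finset.sum_Icc_succ_top (by omega), Finset.sum_Icc_succ_top (by omega)]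
    exact (add_le_add_left ih _).trans
      (two_mul_sqrt_add_div_sqrt_add_le (Finset.sum_nonneg fun i _ => ha i) (ha (n + 1)))
end

section
/- Let λ ≥ 0, η ≥ 0, and x₀, p ∈ ℝ^d. Then the proximal update and the AdamW-style update differ by an explicit second-order term: (1 + λη)⁻¹ (x₀ − η p) − ( (1 − λη) x₀ − η p ) = (λη²/(1 + λη)) (λ x₀ + p). Consequently, the Euclidean norm of the difference is at most λη² (λ‖x₀‖ + ‖p‖), which is O(λη²) as η → 0; hence the AdamW update (1 − λη)x₀ − ηp is the first-order Taylor approximation in η of the proximal update (1 + λη)⁻¹(x₀ − ηp). -/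
/-- the proximal update `(1+λη)⁻¹(x₀ − ηp)` and the AdamW-style update
`(1−λη)x₀ − ηp` differ by the explicit second-order term `(λη²/(1+λη))(λx₀ + p)`, whose
Euclidean norm is at most `λη²(λ‖x₀‖ + ‖p‖) = O(λη²)`; hence AdamW is the first-order
Taylor approximation in `η` of the proximal update. -/
theorem stmt12 (d : ℕ) (lam η : ℝ) (hlam : 0 ≤ lam) (hη : 0 ≤ η)
    (x0 p : EuclideanSpace ℝ (Fin d)) :
    ((1 + lam * η)⁻¹ • (x0 - η • p) - ((1 - lam * η) • x0 - η • p)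
        = (lam * η ^ 2 / (1 + lam * η)) • (lam • x0 + p))
    ∧ ‖(1 + lam * η)⁻¹ • (x0 - η • p) - ((1 - lam * η) • x0 - η • p)‖
        ≤ lam * η ^ 2 * (lam * ‖x0‖ + ‖p‖) := by
  have hpos : 0 < 1 + lam * η := by positivity
  have key : (1 + lam * η)⁻¹ • (x0 - η • p) - ((1 - lam * η) • x0 - η • p)
      = (lam * η ^ 2 / (1 + lam * η)) • (lam • x0 + p) := by
    match_scalars <;> field_simp <;> ring
  refine ⟨key, ?_⟩
  rw [key, norm_smul, Real.norm_of_nonneg (by positivity)]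
  gcongr
  · exact div_le_self (by positivity) (le_add_of_nonneg_right (by positivity))
  · calc ‖lam • x0 + p‖ ≤ ‖lam • x0‖ + ‖p‖ := norm_add_le _ _
      _ = lam * ‖x0‖ + ‖p‖ := by rw [norm_smul, Real.norm_of_nonneg hlam]
end

section
/- Fix β₁ ∈ [0,1), β₂ ∈ [0,1), stepsizes η_t > 0, α > 0, λ ≥ 0, an initial point x₀ ∈ ℝ^d, and per-coordinate scales c₁,…,c_d > 0. Given a sequence of gradients g_t ∈ ℝ^d, define the AdamW iterates with ε = 0 by m₀ = v₀ = 0, m_t = β₁ m_{t−1} + (1−β₁) g_t, v_t = β₂ v_{t−1} + (1−β₂) g_t² (coordinate-wise square), m̂_t = m_t/(1−β₁ᵗ), v̂_t = v_t/(1−β₂ᵗ), and x_t = (1 − λη_t) x_{t−1} − η_t α m̂_t/√(v̂_t) coordinate-wise (with the convention that a coordinate with v̂_{t,j} = 0 contributes 0 to the adaptive term). Let g'_t be the coordinate-wise rescaled gradients g'_{t,j} = c_j g_{t,j}, and let x'_t be the AdamW iterates defined by the same recursion from the same x₀ using g'_t. Then x'_t = x_t for all t; i.e., the AdamW update with ε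 = 0 is scale-free. -/
/-- First moment estimate of Adam/AdamW: `m₀ = 0`, `m_t = β₁ m_{t−1} + (1−β₁) g_t`. -/
noncomputable def adamM (d : ℕ) (β1 : ℝ) (g : ℕ → Fin d → ℝ) : ℕ → Fin d → ℝ
  | 0 => 0
  | t + 1 => fun j => β1 * adamM d β1 g t j + (1 - β1) * g (t + 1) j

/-- Second moment estimate of Adam/AdamW: `v₀ = 0`, `v_t = β₂ v_{t−1} + (1−β₂) g_t²`. -/
noncomputable def adamV (d : ℕ) (β2 : ℝ) (g : ℕ → Fin d → ℝ) : ℕ → Fin d → ℝ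
  | 0 => 0
  | t + 1 => fun j => β2 * adamV d β2 g t j + (1 - β2) * (g (t + 1) j) ^ 2

/-- AdamW iterates with `ε = 0`:
`x_t = (1 − λη_t) x_{t−1} − η_t α m̂_t / √(v̂_t)` coordinate-wise, where
`m̂_t = m_t/(1−β₁ᵗ)`, `v̂_t = v_t/(1−β₂ᵗ)`. (By Lean's division-by-zero convention, a
coordinate with `v̂_{t,j} = 0` contributes `0` to the adaptive term.) -/
noncomputable def adamWX (d : ℕ) (β1 β2 α lam : ℝ) (η : ℕ → ℝ)
    (x0 : Fin d → ℝ) (g : ℕ → Fin d → ℝ) : ℕ → Fin d → ℝ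
  | 0 => x0
  | t + 1 => fun j =>
      (1 - lam * η (t + 1)) * adamWX d β1 β2 α lam η x0 g t j
        - η (t + 1) * α *
          ((adamM d β1 g (t + 1) j / (1 - β1 ^ (t + 1)))
            / Real.sqrt (adamV d β2 g (t + 1) j / (1 - β2 ^ (t + 1))))

theorem adamM_mul_left (d : ℕ) (β1 : ℝ) (g : ℕ → Fin d → ℝ) (c : Fin d → ℝ) (t : ℕ) (j : Fin d) :
    adamM d β1 (fun t j => c j * g t j) t j = c j * adamM d β1 g t j := by
  induction t with
  | zero => simp [adamM]
  | succ t ih => simp only [adamM, ih]; ring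

theorem adamV_mul_left (d : ℕ) (β2 : ℝ) (g : ℕ → Fin d → ℝ) (c : Fin d → ℝ) (t : ℕ) (j : Fin d) :
    adamV d β2 (fun t j => c j * g t j) t j = c j ^ 2 * adamV d β2 g t j := by
  induction t with
  | zero => simp [adamV]
  | succ t ih => simp only [adamV, ih]; ring

/-- the AdamW update with `ε = 0` is scale-free: multiplying every coordinate
`j` of all the gradients by a fixed constant `c_j > 0` leaves all iterates unchanged. -/
theorem stmt13 (d : ℕ) (β1 β2 α lam : ℝ)
    (hβ1 : β1 ∈ Set.Ico (0 : ℝ) 1) (hβ2 : β2 ∈ Set.Ico (0 : ℝ) 1)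
    (hα : 0 < α) (hlam : 0 ≤ lam)
    (η : ℕ → ℝ) (hη : ∀ t, 0 < η t)
    (x0 : Fin d → ℝ) (g : ℕ → Fin d → ℝ)
    (c : Fin d → ℝ) (hc : ∀ j, 0 < c j) :
    ∀ t, adamWX d β1 β2 α lam η x0 (fun t j => c j * g t j) t
      = adamWX d β1 β2 α lam η x0 g t := by
  intro t
  induction t with
  | zero => rfl
  | succ t ih =>
    funext j
    simp only [adamWX, ih]
    rw [adamM_mul_left, adamV_mul_left, mul_div_assoc (c j), mul_div_assoc (c j ^ 2),
      Real.sqrt_mul (sq_nonneg (c j)), Real.sqrt_sq (hc j).le, mul_div_mul_left _ _ (hc j).ne']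
end

section
/- Fix η > 0, an initial point x₀ ∈ ℝ^d, and per-coordinate scales c₁,…,c_d > 0. Let f, g : ℝ^d → ℝ be differentiable with ∂_j g(x) = c_j ∂_j f(x) for all x and all coordinates j. Define the (unprojected, ε = 0) AdaGrad iterates on f by x_{t+1,j} = x_{t,j} − (η/√(∑_{i=1}^t (∂_j f(x_i))²)) ∂_j f(x_t) when ∑_{i=1}^t (∂_j f(x_i))² > 0 and x_{t+1,j} = x_{t,j} otherwise, starting from x₁ = x₀; define y_t analogously on g from y₁ = x₀. Then y_t = x_t for all t. -/
/-- unprojected diagonal AdaGrad (with `ε = 0`, exact gradients) is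
scale-free: if `∂ⱼg(x) = cⱼ ∂ⱼf(x)` for all `x, j` with `cⱼ > 0`, then the AdaGrad
iterates on `g` coincide with those on `f` when started from the same point. -/
theorem stmt14 (d : ℕ) (η : ℝ) (hη : 0 < η)
    (x0 : Fin d → ℝ) (c : Fin d → ℝ) (hc : ∀ j, 0 < c j)
    (f g : (Fin d → ℝ) → ℝ) (hf : Differentiable ℝ f) (hg : Differentiable ℝ g)
    (hcg : ∀ (z : Fin d → ℝ) (j : Fin d),
      fderiv ℝ g z (Pi.single j 1) = c j * fderiv ℝ f z (Pi.single j 1))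
    (x y : ℕ → Fin d → ℝ) (hx1 : x 1 = x0) (hy1 : y 1 = x0)
    (hxupd : ∀ t, 1 ≤ t → ∀ j : Fin d,
      (0 < ∑ i ∈ Finset.Icc 1 t, (fderiv ℝ f (x i) (Pi.single j 1)) ^ 2 →
        x (t + 1) j = x t j
          - η / Real.sqrt (∑ i ∈ Finset.Icc 1 t, (fderiv ℝ f (x i) (Pi.single j 1)) ^ 2)
            * fderiv ℝ f (x t) (Pi.single j 1))
      ∧ (∑ i ∈ Finset.Icc 1 t, (fderiv ℝ f (x i) (Pi.single j 1)) ^ 2 ≤ 0 →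
        x (t + 1) j = x t j))
    (hyupd : ∀ t, 1 ≤ t → ∀ j : Fin d,
      (0 < ∑ i ∈ Finset.Icc 1 t, (fderiv ℝ g (y i) (Pi.single j 1)) ^ 2 →
        y (t + 1) j = y t j
          - η / Real.sqrt (∑ i ∈ Finset.Icc 1 t, (fderiv ℝ g (y i) (Pi.single j 1)) ^ 2)
            * fderiv ℝ g (y t) (Pi.single j 1))
      ∧ (∑ i ∈ Finset.Icc 1 t, (fderiv ℝ g (y i) (Pi.single j 1)) ^ 2 ≤ 0 →
        y (t + 1) j = y t j)) :
    ∀ t, 1 ≤ t → y t = x t := by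
  intro t
  induction t using Nat.strong_induction_on with
  | _ t ih =>
    intro ht
    obtain rfl | ⟨s, hs, rfl⟩ : t = 1 ∨ ∃ s, 1 ≤ s ∧ t = s + 1 := by
      rcases Nat.lt_or_ge 1 t with h | h
      · exact Or.inr ⟨t - 1, by omega, by omega⟩
      · exact Or.inl (le_antisymm h ht)
    · rw [hx1, hy1]
    · funext j
      have hcj := hc j
      have hys : y s = x s := ih s s.lt_succ_self hs
      have hsum : ∑ i ∈ Finset.Icc 1 s, (fderiv ℝ g (y i) (Pi.single j 1)) ^ 2
          = c j ^ 2 * ∑ i ∈ Finset.Icc 1 s, (fderiv ℝ f (x i) (Pi.single j 1)) ^ 2 := by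
        rw [Finset.mul_sum]
        refine Finset.sum_congr rfl fun i hi => ?_
        obtain ⟨h1, h2⟩ := Finset.mem_Icc.mp hi
        rw [ih i (Nat.lt_succ_of_le h2) h1, hcg, mul_pow]
      obtain ⟨hxpos, hxzero⟩ := hxupd s hs j
      obtain ⟨hypos, hyzero⟩ := hyupd s hs j
      rw [hsum, hys, hcg] at hypos
      rw [hsum, hys] at hyzero
      rcases lt_or_ge 0 (∑ i ∈ Finset.Icc 1 s, (fderiv ℝ f (x i) (Pi.single j 1)) ^ 2) with h | h
      · rw [hxpos h, hypos (by positivity), Real.sqrt_mul (sq_nonneg _), Real.sqrt_sq hcj.le]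
        have hsqrt := Real.sqrt_pos.mpr h
        field_simp
      · rw [hxzero h, hyzero (mul_nonpos_of_nonneg_of_nonpos (sq_nonneg _) h)]
end
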